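/- Let P ⊆ ℝ² be arithmetically definable. Then there is no sequence of reals (x_n)_{n∈ℕ} such that for every n: (i) the Turing jump x'_{n+1} of x_{n+1} is Turing reducible to x_n, and (ii) x_{n+1} is the unique real y such that P(x_n, y). -/

import Mathlib

open FirstOrder FirstOrder.Language Nat

namespace SteelFormalization

/-- Oracle partial recursive functions: `RecursiveIn O f` means that the partial
function `f` is partial recursive relative to the (total) oracle `O`. -/
inductive RecursiveIn (O : ℕ → ℕ) : (ℕ →. ℕ) → Prop
  | zero : RecursiveIn O (pure 0)
  | succ : RecursiveIn O Nat.succ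
  | left : RecursiveIn O ↑fun n : ℕ => n.unpair.1
  | right : RecursiveIn O ↑fun n : ℕ => n.unpair.2
  | oracle : RecursiveIn O ↑O
  | pair {f g} : RecursiveIn O f → RecursiveIn O g →
      RecursiveIn O fun n => pair <$> f n <*> g n
  | comp {f g} : RecursiveIn O f → RecursiveIn O g →
      RecursiveIn O fun n => g n >>= f
  | prec {f g} : RecursiveIn O f → RecursiveIn O g →
      RecursiveIn O (unpaired fun a n =>
        n.rec (f a) fun y IH => do let i ← IH; g (pair a (pair y i)))
  | rfind {f} : RecursiveIn O f →
      RecursiveIn O fun a => rfind fun n => (fun m => m = 0) <$> f (pair a n)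

/-- `x ≤_T y`: the real `x` is Turing reducible to the real `y`. -/
def TuringLE (x y : ℕ → Bool) : Prop :=
  RecursiveIn (fun n => (y n).toNat) ↑(fun n => (x n).toNat)

/-- `S` is `Σ⁰₁` in `x` (`x`-recursively enumerable): `S` is the domain of a partial
function that is partial recursive in `x`. -/
def Sigma01In (x : ℕ → Bool) (S : Set ℕ) : Prop :=
  ∃ g : ℕ →. ℕ, RecursiveIn (fun n => (x n).toNat) g ∧ S = {n | (g n).Dom}

/-- `j` is (a copy of) the Turing jump `x'` of `x`: an `x`-r.e. set that is complete
for `x`-r.e. sets with respect to many-one reducibility (the halting problem relative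
to `x` is such a set). -/
def IsJump (x j : ℕ → Bool) : Prop :=
  Sigma01In x {n | j n = true} ∧
    ∀ S : Set ℕ, Sigma01In x S → ManyOneReducible (· ∈ S) (fun n => j n = true)

/-- Function symbols of the language of arithmetic with two real parameters:
`0`, successor, `+`, `·`. -/
inductive Func : ℕ → Type
  | zero : Func 0
  | succ : Func 1
  | add : Func 2
  | mul : Func 2

/-- Relation symbols: `≤` and two unary predicate symbols standing for the two real
parameters. -/
inductive Rel : ℕ → Type
  | fst : Rel 1
  | snd : Rel 1
  | le : Rel 2

/-- The language of arithmetic with two real parameters. -/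
def L : Language := ⟨Func, Rel⟩

/-- The standard model `ℕ`, interpreting the two unary predicates as the reals
`x` and `y`. -/
def str (x y : ℕ → Bool) : L.Structure ℕ where
  funMap {n} F v :=
    match F with
    | .zero => 0
    | .succ => v 0 + 1
    | .add => v 0 + v 1
    | .mul => v 0 * v 1
  RelMap {n} r v :=
    match r with
    | .fst => x (v 0) = true
    | .snd => y (v 0) = true
    | .le => v 0 ≤ v 1

/-- `P ⊆ ℝ²` is arithmetic(ally definable): it is defined, over the standard model,
by a formula of second-order arithmetic with only number quantifiers and the two
reals as parameters. -/
def IsArithmetic (P : (ℕ → Bool) → (ℕ → Bool) → Prop) : Prop :=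
  ∃ ψ : L.Sentence, ∀ x y, P x y ↔ (letI := str x y; ψ.Realize ℕ)

def pref (x : ℕ → Bool) (s : ℕ) : List Bool := (List.range s).map x

theorem pref_length (x : ℕ → Bool) (s : ℕ) : (pref x s).length = s := by simp [pref]

theorem pref_succ (x : ℕ → Bool) (s : ℕ) : pref x (s+1) = pref x s ++ [x s] := by
  simp [pref, List.range_succ]

theorem pref_getElem (x : ℕ → Bool) (s n : ℕ) :
    (pref x s)[n]? = if n < s then some (x n) else none := by
  by_cases h : n < s
  · simp [pref, h]
  · simp [pref, h]

/-- Nonuniform `Σ₁` in `x` in normal form. -/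
def SW (x : ℕ → Bool) {α : Type} [Primcodable α] (A : α → Prop) : Prop :=
  ∃ R : List Bool → α → Prop, PrimrecRel R ∧
    (∀ a s t, s ≤ t → R (pref x s) a → R (pref x t) a) ∧ ∀ a, A a ↔ ∃ s, R (pref x s) a

section
variable {x : ℕ → Bool} {α β : Type} [Primcodable α] [Primcodable β]

theorem SW.of_primrec {A : α → Prop} (h : PrimrecPred A) : SW x A :=
  ⟨fun _ a => A a, h.comp Primrec.snd, fun _ _ _ _ h => h, fun a => by simp⟩

theorem SW.of_eq {A B : α → Prop} (h : SW x A) (e : ∀ a, A a ↔ B a) : SW x B := by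
  have : A = B := funext fun a => propext (e a)
  exact this ▸ h

theorem SW.comp {A : β → Prop} (h : SW x A) {f : α → β} (hf : Primrec f) :
    SW x (fun a => A (f a)) := by
  obtain ⟨R, h1, h2, h3⟩ := h
  exact ⟨fun s a => R s (f a), PrimrecRel.comp h1 Primrec.fst (hf.comp Primrec.snd),
    fun a => h2 (f a), fun a => h3 (f a)⟩

theorem SW.and {A B : α → Prop} (h : SW x A) (h' : SW x B) : SW x (fun a => A a ∧ B a) := by
  obtain ⟨R, h1, h2, h3⟩ := h
  obtain ⟨R', h1', h2', h3'⟩ := h'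
  refine ⟨fun s a => R s a ∧ R' s a, PrimrecPred.and h1 h1',
    fun a s t st h => ⟨h2 a s t st h.1, h2' a s t st h.2⟩, fun a => ?_⟩
  show A a ∧ B a ↔ ∃ s, R (pref x s) a ∧ R' (pref x s) a
  rw [h3, h3']
  constructor
  · rintro ⟨⟨s, hs⟩, t, ht⟩
    exact ⟨max s t, h2 _ _ _ (le_max_left _ _) hs, h2' _ _ _ (le_max_right _ _) ht⟩
  · rintro ⟨s, hs, ht⟩
    exact ⟨⟨s, hs⟩, s, ht⟩

theorem SW.ex {A : α → ℕ → Prop} (h : SW x (fun p : α × ℕ => A p.1 p.2)) :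
    SW x (fun a => ∃ n, A a n) := by
  obtain ⟨R, h1, h2, h3⟩ := h
  have hR : PrimrecRel (fun (n : ℕ) (p : List Bool × α) => R p.1 (p.2, n)) :=
    PrimrecRel.comp h1 (Primrec.fst.comp Primrec.snd)
      ((Primrec.snd.comp Primrec.snd).pair Primrec.fst)
  refine ⟨fun s a => ∃ n < s.length, R s (a, n),
    show PrimrecPred (fun p : List Bool × α => ∃ n < p.1.length, R p.1 (p.2, n)) from
      (PrimrecRel.comp hR.exists_mem_list (Primrec.list_range.comp (Primrec.list_length.comp Primrec.fst))
        (Primrec.id (α := List Bool × α))).of_eq (by simp), ?_, ?_⟩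
  · rintro a s t st ⟨n, hn, h⟩
    rw [pref_length] at hn
    exact ⟨n, by rw [pref_length]; omega, h2 _ _ _ st h⟩
  · intro a
    constructor
    · rintro ⟨n, hn⟩
      obtain ⟨s, hs⟩ := (h3 (a, n)).1 hn
      exact ⟨max s (n+1), n, by rw [pref_length]; omega, h2 _ _ _ (le_max_left _ _) hs⟩
    · rintro ⟨s, n, -, h⟩
      exact ⟨n, (h3 (a, n)).2 ⟨s, h⟩⟩

theorem SW.allLt {A : α → ℕ → Prop} (h : SW x (fun p : α × ℕ => A p.1 p.2)) {f : α → ℕ}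
    (hf : Primrec f) : SW x (fun a => ∀ i < f a, A a i) := by
  obtain ⟨R, h1, h2, h3⟩ := h
  have hR : PrimrecRel (fun (n : ℕ) (p : List Bool × α) => R p.1 (p.2, n)) :=
    PrimrecRel.comp h1 (Primrec.fst.comp Primrec.snd)
      ((Primrec.snd.comp Primrec.snd).pair Primrec.fst)
  refine ⟨fun s a => ∀ n < f a, R s (a, n),
    show PrimrecPred (fun p : List Bool × α => ∀ n < f p.2, R p.1 (p.2, n)) from
      (PrimrecRel.comp hR.forall_mem_list (Primrec.list_range.comp (hf.comp Primrec.snd))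
        (Primrec.id (α := List Bool × α))).of_eq (by simp), ?_, ?_⟩
  · intro a s t st h n hn
    exact h2 _ _ _ st (h n hn)
  · intro a
    constructor
    · intro h
      have : ∀ m ≤ f a, ∃ s, ∀ n < m, R (pref x s) (a, n) := by
        intro m
        induction m with
        | zero => intro _; exact ⟨0, by simp⟩
        | succ m ih =>
          intro hm
          obtain ⟨s, hs⟩ := ih (by omega)
          obtain ⟨t, ht⟩ := (h3 (a, m)).1 (h m (by omega))
          refine ⟨max s t, fun n hn => ?_⟩
          rcases Nat.lt_succ_iff_lt_or_eq.1 hn with h | rfl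
          · exact h2 _ _ _ (le_max_left _ _) (hs n h)
          · exact h2 _ _ _ (le_max_right _ _) ht
      exact this _ le_rfl
    · rintro ⟨s, h⟩ i hi
      exact (h3 (a, i)).2 ⟨s, h i hi⟩

theorem prec_mem {f g : ℕ →. ℕ} (a n v : ℕ) :
    v ∈ (Nat.rec (f a) (fun y IH => do let i ← IH; g (Nat.pair a (Nat.pair y i))) n : Part ℕ) ↔
    ∃ m, (Denumerable.ofNat (List ℕ) m).getD 0 0 ∈ f a ∧
      (∀ i < n, (Denumerable.ofNat (List ℕ) m).getD (i+1) 0 ∈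
        g (Nat.pair a (Nat.pair i ((Denumerable.ofNat (List ℕ) m).getD i 0)))) ∧
      v = (Denumerable.ofNat (List ℕ) m).getD n 0 := by
  constructor
  · intro h
    have : ∃ l : List ℕ, l.length = n + 1 ∧ l.getD 0 0 ∈ f a ∧
      (∀ i < n, l.getD (i+1) 0 ∈ g (Nat.pair a (Nat.pair i (l.getD i 0)))) ∧ v = l.getD n 0 := by
      induction n generalizing v with
      | zero => exact ⟨[v], by simpa using h⟩
      | succ n ih =>
        obtain ⟨w, hw, hv⟩ := Part.mem_bind_iff.1 h
        obtain ⟨l, h0, h1, h2, h3⟩ := ih w hw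
        have key : ∀ i ≤ n, (l ++ [v]).getD i 0 = l.getD i 0 := fun i hi =>
          List.getD_append _ _ _ _ (by omega)
        have kk : (l ++ [v]).getD (n+1) 0 = v := by
          rw [← h0]; simp
        refine ⟨l ++ [v], by simp [h0], ?_, ?_, ?_⟩
        · rw [key 0 (by omega)]; exact h1
        · intro i hi
          rcases Nat.lt_succ_iff_lt_or_eq.1 hi with h | rfl
          · rw [key _ (by omega), key _ (by omega)]; exact h2 i h
          · rw [kk, key _ le_rfl, ← h3]; exact hv
        · exact kk.symm
    obtain ⟨l, -, h⟩ := this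
    refine ⟨Encodable.encode l, ?_⟩
    simpa using h
  · rintro ⟨m, h1, h2, h3⟩
    generalize Denumerable.ofNat (List ℕ) m = l at *
    subst h3
    induction n with
    | zero => exact h1
    | succ n ih =>
      exact Part.mem_bind_iff.2 ⟨_, ih fun i hi => h2 i (by omega), h2 n (by omega)⟩

theorem SW.graph {f : ℕ →. ℕ} (h : RecursiveIn (fun n => (x n).toNat) f) :
    SW x (fun p : ℕ × ℕ => p.2 ∈ f p.1) := by
  have ofFun : ∀ {f : ℕ → ℕ}, Primrec f → SW x (fun p : ℕ × ℕ => p.2 ∈ (f : ℕ →. ℕ) p.1) := by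
    intro f hf
    refine SW.of_eq (SW.of_primrec (A := fun p : ℕ × ℕ => p.2 = f p.1)
      (Primrec.eq.comp Primrec.snd (hf.comp Primrec.fst))) ?_
    intro p; simp
  have pr : Primrec₂ Nat.pair := Primrec₂.natPair
  have l0 : Primrec (fun m => Denumerable.ofNat (List ℕ) m) := Primrec.ofNat _
  induction h with
  | zero => exact ofFun (Primrec.const 0)
  | succ => exact ofFun Primrec.succ
  | left => exact ofFun (Primrec.fst.comp Primrec.unpair)
  | right => exact ofFun (Primrec.snd.comp Primrec.unpair)
  | oracle =>
    refine ⟨fun s p => (s[p.1]?).map Bool.toNat = some p.2, ?_, ?_, ?_⟩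
    · refine Primrec.eq.comp (Primrec.option_map (Primrec.list_getElem?.comp Primrec.fst
        (Primrec.fst.comp Primrec.snd)) ?_) (Primrec.option_some.comp (Primrec.snd.comp Primrec.snd))
      exact (Primrec.dom_finite Bool.toNat).comp Primrec.snd
    · intro a s t st
      simp only [pref_getElem]
      split_ifs <;> simp
      omega
    · intro a
      simp only [pref_getElem]
      constructor
      · intro h
        refine ⟨a.1+1, ?_⟩
        simp at h ⊢
        exact h.symm
      · rintro ⟨s, hs⟩
        split_ifs at hs
        · simp at hs ⊢
          exact hs.symm
        · simp at hs
  | @pair f g _ _ hf hg =>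
    refine SW.of_eq ((hf.comp (f := fun p : ℕ × ℕ => (p.1, p.2.unpair.1)) ?_).and
      (hg.comp (f := fun p : ℕ × ℕ => (p.1, p.2.unpair.2)) ?_)) ?_
    · exact Primrec.fst.pair (Primrec.fst.comp (Primrec.unpair.comp Primrec.snd))
    · exact Primrec.fst.pair (Primrec.snd.comp (Primrec.unpair.comp Primrec.snd))
    · rintro ⟨n, v⟩
      simp only [Seq.seq, Part.mem_bind_iff]
      simp
      constructor
      · rintro ⟨h1, h2⟩
        exact ⟨_, h1, _, h2, by simp⟩
      · rintro ⟨a, h1, b, h2, rfl⟩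
        simpa using ⟨h1, h2⟩
  | @comp f g _ _ hf hg =>
    refine SW.of_eq (SW.ex (A := fun (p : ℕ × ℕ) w => w ∈ g p.1 ∧ p.2 ∈ f w)
      ((hg.comp (f := fun p : (ℕ × ℕ) × ℕ => (p.1.1, p.2)) ?_).and
      (hf.comp (f := fun p : (ℕ × ℕ) × ℕ => (p.2, p.1.2)) ?_))) ?_
    · exact (Primrec.fst.comp Primrec.fst).pair Primrec.snd
    · exact Primrec.snd.pair (Primrec.snd.comp Primrec.fst)
    · rintro ⟨n, v⟩
      exact Part.mem_bind_iff.symm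
  | @prec f g _ _ hf hg =>
    have e1 : Primrec (fun p : (ℕ × ℕ) × ℕ => p.1.1.unpair.1) :=
      Primrec.fst.comp (Primrec.unpair.comp (Primrec.fst.comp Primrec.fst))
    have e2 : Primrec (fun p : (ℕ × ℕ) × ℕ => p.1.1.unpair.2) :=
      Primrec.snd.comp (Primrec.unpair.comp (Primrec.fst.comp Primrec.fst))
    have e3 : Primrec (fun p : (ℕ × ℕ) × ℕ => Denumerable.ofNat (List ℕ) p.2) :=
      l0.comp Primrec.snd
    have gd : Primrec₂ (fun (l : List ℕ) n => l.getD n 0) := Primrec.list_getD 0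
    refine SW.of_eq (SW.ex (A := fun (p : ℕ × ℕ) m =>
      (Denumerable.ofNat (List ℕ) m).getD 0 0 ∈ f p.1.unpair.1 ∧
      (∀ i < p.1.unpair.2, (Denumerable.ofNat (List ℕ) m).getD (i+1) 0 ∈
        g (Nat.pair p.1.unpair.1 (Nat.pair i ((Denumerable.ofNat (List ℕ) m).getD i 0)))) ∧
      p.2 = (Denumerable.ofNat (List ℕ) m).getD p.1.unpair.2 0)
      ((hf.comp (f := fun p : (ℕ × ℕ) × ℕ =>
          (p.1.1.unpair.1, (Denumerable.ofNat (List ℕ) p.2).getD 0 0)) ?_).and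
        ((SW.allLt (A := fun (p : (ℕ × ℕ) × ℕ) i => (Denumerable.ofNat (List ℕ) p.2).getD (i+1) 0 ∈
        g (Nat.pair p.1.1.unpair.1 (Nat.pair i ((Denumerable.ofNat (List ℕ) p.2).getD i 0))))
          (hg.comp (f := fun p : ((ℕ × ℕ) × ℕ) × ℕ =>
          (Nat.pair p.1.1.1.unpair.1 (Nat.pair p.2 ((Denumerable.ofNat (List ℕ) p.1.2).getD p.2 0)),
           (Denumerable.ofNat (List ℕ) p.1.2).getD (p.2+1) 0)) ?_) e2).and
           (SW.of_primrec ?_)))) ?_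
    · exact e1.pair (gd.comp e3 (Primrec.const 0))
    · exact (pr.comp (e1.comp Primrec.fst) (pr.comp Primrec.snd
        (gd.comp (e3.comp Primrec.fst) Primrec.snd))).pair
        (gd.comp (e3.comp Primrec.fst) (Primrec.succ.comp Primrec.snd))
    · exact Primrec.eq.comp (Primrec.snd.comp Primrec.fst) (gd.comp e3 e2)
    · rintro ⟨n, v⟩
      exact (prec_mem _ _ _).symm
  | @rfind f _ hf =>
    refine SW.of_eq ((hf.comp (f := fun p : ℕ × ℕ => (Nat.pair p.1 p.2, 0)) ?_).and
      (SW.allLt (A := fun (p : ℕ × ℕ) i => ∃ w, w + 1 ∈ f (Nat.pair p.1 i))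
        (SW.ex (A := fun (p : (ℕ × ℕ) × ℕ) w => w + 1 ∈ f (Nat.pair p.1.1 p.2))
        (hf.comp (f := fun p : ((ℕ × ℕ) × ℕ) × ℕ => (Nat.pair p.1.1.1 p.1.2, p.2 + 1)) ?_))
        (f := fun p => p.2) Primrec.snd)) ?_
    · exact (pr.comp Primrec.fst Primrec.snd).pair (Primrec.const 0)
    · exact (pr.comp (Primrec.fst.comp (Primrec.fst.comp Primrec.fst))
        (Primrec.snd.comp Primrec.fst)).pair (Primrec.succ.comp Primrec.snd)
    · rintro ⟨n, v⟩
      show (0 ∈ f (Nat.pair n v) ∧ ∀ i < v, ∃ w, w + 1 ∈ f (Nat.pair n i)) ↔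
        v ∈ Nat.rfind fun k => (fun m => decide (m = 0)) <$> f (Nat.pair n k)
      refine Iff.trans ?_ Nat.mem_rfind.symm
      simp
      intro _
      constructor
      · intro h m hm
        obtain ⟨w, hw⟩ := h m hm
        exact ⟨_, hw, by simp⟩
      · intro h m hm
        obtain ⟨w, hw, h0⟩ := h hm
        obtain ⟨u, rfl⟩ := Nat.exists_eq_succ_of_ne_zero h0
        exact ⟨u, hw⟩

end

open Nat.Partrec (Code)

/-- Universal `Σ_{k+1}` predicates. -/
def U : ℕ → (ℕ → Bool) → ℕ → ℕ → Prop
  | 0, x, e, v => ∃ s, (Code.eval (Denumerable.ofNat Code e)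
      (Nat.pair (Encodable.encode (pref x s)) v)).Dom
  | k+1, x, e, v => ∃ s, ¬ U k x e (Nat.pair v s)

theorem univ0 {α : Type} [Primcodable α] {R : List Bool → α → Prop} (h : PrimrecRel R) :
    ∃ e, ∀ σ a, R σ a ↔ (Code.eval (Denumerable.ofNat Code e)
      (Nat.pair (Encodable.encode σ) (Encodable.encode a))).Dom := by
  have h1 : REPred (fun p : List Bool × α => R p.1 p.2) := by
    obtain ⟨i, hp⟩ := h
    exact ComputablePred.to_re ⟨i, hp.to_comp⟩
  have h2 : Nat.Partrec _ := h1
  obtain ⟨c, hc⟩ := Code.exists_code.1 h2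
  refine ⟨Encodable.encode c, fun σ a => ?_⟩
  rw [Denumerable.ofNat_encode, hc]
  have : Nat.pair (Encodable.encode σ) (Encodable.encode a) = Encodable.encode (σ, a) := rfl
  rw [this]
  beta_reduce
  rw [Encodable.encodek]
  simp [Part.assert]

theorem SW.index {x : ℕ → Bool} {A : ℕ → Prop} (h : SW x A) : ∃ e, ∀ v, A v ↔ U 0 x e v := by
  obtain ⟨R, h1, -, h3⟩ := h
  obtain ⟨e, he⟩ := univ0 h1
  refine ⟨e, fun v => ?_⟩
  rw [h3]
  simp only [U, he]
  rfl

def Sig : ℕ → ∀ (α : Type) [Primcodable α], ((ℕ → Bool) → α → Prop) → Prop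
  | 0, _, _, A => ∃ R : List Bool → _ → Prop, PrimrecRel R ∧
      (∀ x a s t, s ≤ t → R (pref x s) a → R (pref x t) a) ∧ ∀ x a, A x a ↔ ∃ s, R (pref x s) a
  | k+1, α, _, A => ∃ B : (ℕ → Bool) → α × ℕ → Prop, Sig k (α × ℕ) B ∧
      ∀ x a, A x a ↔ ∃ s, ¬ B x (a, s)

theorem Sig.univ (k : ℕ) : ∀ {α : Type} [Primcodable α] {A : (ℕ → Bool) → α → Prop},
    Sig k α A → ∃ e, ∀ x a, A x a ↔ U k x e (Encodable.encode a) := by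
  induction k with
  | zero =>
    rintro α _ A ⟨R, h1, h2, h3⟩
    obtain ⟨e, he⟩ := univ0 h1
    refine ⟨e, fun x v => ?_⟩
    rw [h3]
    simp only [U, he]
  | succ k ih =>
    rintro α _ A ⟨B, h1, h3⟩
    obtain ⟨e, he⟩ := ih h1
    refine ⟨e, fun x v => ?_⟩
    rw [h3]
    simp only [U, he]
    rfl

theorem Sig.comp (k : ℕ) : ∀ {α β : Type} [Primcodable α] [Primcodable β]
    {A : (ℕ → Bool) → β → Prop} (_ : Sig k β A) {f : α → β} (_ : Primrec f),
    Sig k α (fun x a => A x (f a)) := by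
  induction k with
  | zero =>
    rintro α β _ _ A ⟨R, h1, h2, h3⟩ f hf
    exact ⟨fun s a => R s (f a), PrimrecRel.comp h1 Primrec.fst (hf.comp Primrec.snd),
      fun x a => h2 x (f a), fun x a => h3 x (f a)⟩
  | succ k ih =>
    rintro α β _ _ A ⟨B, h1, h3⟩ f hf
    exact ⟨_, ih h1 (f := fun p : α × ℕ => (f p.1, p.2)) ((hf.comp Primrec.fst).pair Primrec.snd),
      fun x a => h3 x (f a)⟩

theorem pref_take (x : ℕ → Bool) {m s : ℕ} (h : m ≤ s) : (pref x s).take m = pref x m := by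
  simp [pref, ← List.map_take, List.take_range, h]

theorem Sig.pref {α : Type} [Primcodable α] {R : List Bool → α → Prop} (h : PrimrecRel R)
    {f : α → ℕ} (hf : Primrec f) : Sig 0 α (fun x a => R (pref x (f a)) a) := by
  refine ⟨fun s a => f a ≤ s.length ∧ R (s.take (f a)) a, PrimrecPred.and (Primrec.nat_le.comp
    (hf.comp Primrec.snd) (Primrec.list_length.comp Primrec.fst)) (PrimrecRel.comp h
    (Primrec.list_take.comp (hf.comp Primrec.snd) Primrec.fst) Primrec.snd), ?_, fun x a => ?_⟩
  · rintro x a s t st ⟨h1, h2⟩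
    rw [pref_length] at h1
    rw [pref_take _ h1] at h2
    rw [pref_length, pref_take _ (h1.trans st)]
    exact ⟨h1.trans st, h2⟩
  · constructor
    · intro h
      exact ⟨f a, by rw [pref_length], by rwa [pref_take _ le_rfl]⟩
    · rintro ⟨s, h1, h2⟩
      rw [pref_length] at h1
      rwa [pref_take _ h1] at h2

theorem Sig.up (k : ℕ) : ∀ {α : Type} [Primcodable α] {A : (ℕ → Bool) → α → Prop},
    Sig k α A → Sig (k+1) α A := by
  induction k with
  | zero =>
    rintro α _ A ⟨R, h1, h2, h3⟩
    refine ⟨_, Sig.pref (R := fun s (p : α × ℕ) => ¬ R s p.1) (f := fun p => p.2)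
      (PrimrecPred.not (PrimrecRel.comp h1 Primrec.fst (Primrec.fst.comp Primrec.snd)))
      Primrec.snd, ?_⟩
    simpa using h3
  | succ k ih =>
    rintro α _ A ⟨B, h1, h3⟩
    exact ⟨B, ih h1, h3⟩

theorem Sig.mono {k l : ℕ} (h : k ≤ l) {α : Type} [Primcodable α] {A : (ℕ → Bool) → α → Prop}
    (hA : Sig k α A) : Sig l α A := by
  induction h with
  | refl => exact hA
  | step _ ih => exact ih.up

theorem Sig.andor (k : ℕ) : ∀ {α : Type} [Primcodable α] {A B : (ℕ → Bool) → α → Prop},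
    Sig k α A → Sig k α B →
    Sig k α (fun x a => A x a ∧ B x a) ∧ Sig k α (fun x a => A x a ∨ B x a) := by
  have un1 : Primrec (fun n : ℕ => n.unpair.1) := Primrec.fst.comp Primrec.unpair
  have un2 : Primrec (fun n : ℕ => n.unpair.2) := Primrec.snd.comp Primrec.unpair
  induction k with
  | zero =>
    rintro α _ A B ⟨R, h1, h2, h3⟩ ⟨R', h1', h2', h3'⟩
    constructor
    · refine ⟨fun s a => R s a ∧ R' s a, PrimrecPred.and h1 h1',
        fun x a s t st h => ⟨h2 x a s t st h.1, h2' x a s t st h.2⟩, fun x a => ?_⟩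
      simp only [h3, h3']
      constructor
      · rintro ⟨⟨s, hs⟩, t, ht⟩
        exact ⟨max s t, h2 _ _ _ _ (le_max_left _ _) hs, h2' _ _ _ _ (le_max_right _ _) ht⟩
      · rintro ⟨s, hs, ht⟩
        exact ⟨⟨s, hs⟩, s, ht⟩
    · refine ⟨fun s a => R s a ∨ R' s a, PrimrecPred.or h1 h1',
        fun x a s t st h => h.imp (h2 x a s t st) (h2' x a s t st), fun x a => ?_⟩
      simp only [h3, h3', exists_or]
  | succ k ih =>
    rintro α _ A B ⟨A', h1, h3⟩ ⟨B', h1', h3'⟩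
    constructor
    · refine ⟨_, (ih (Sig.comp k h1 (f := fun p : α × ℕ => (p.1, p.2.unpair.1))
        (Primrec.fst.pair (un1.comp Primrec.snd)))
        (Sig.comp k h1' (f := fun p : α × ℕ => (p.1, p.2.unpair.2))
        (Primrec.fst.pair (un2.comp Primrec.snd)))).2, fun x a => ?_⟩
      simp only [h3, h3']
      constructor
      · rintro ⟨⟨s, hs⟩, t, ht⟩
        exact ⟨Nat.pair s t, by simp [hs, ht]⟩
      · rintro ⟨s, hs⟩
        rw [not_or] at hs
        exact ⟨⟨_, hs.1⟩, _, hs.2⟩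
    · refine ⟨_, (ih h1 h1').1, fun x a => ?_⟩
      simp only [h3, h3', not_and_or, exists_or]

/-- Uniformly arithmetic predicates. -/
def Arith {α : Type} [Primcodable α] (A : (ℕ → Bool) → α → Prop) : Prop := ∃ k, Sig k α A

section
variable {α β : Type} [Primcodable α] [Primcodable β] {A B : (ℕ → Bool) → α → Prop}

theorem Arith.of_eq (h : Arith A) (e : ∀ x a, A x a ↔ B x a) : Arith B := by
  have : A = B := funext fun x => funext fun a => propext (e x a)
  exact this ▸ h

theorem Arith.comp {A : (ℕ → Bool) → β → Prop} (h : Arith A) {f : α → β} (hf : Primrec f) :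
    Arith (fun x a => A x (f a)) := by
  obtain ⟨k, h⟩ := h
  exact ⟨k, h.comp k hf⟩

theorem Arith.not (h : Arith A) : Arith (fun x a => ¬ A x a) := by
  obtain ⟨k, h⟩ := h
  exact ⟨k+1, _, h.comp k Primrec.fst, fun x a => by simp⟩

theorem Arith.and (h : Arith A) (h' : Arith B) : Arith (fun x a => A x a ∧ B x a) := by
  obtain ⟨k, h⟩ := h
  obtain ⟨k', h'⟩ := h'
  exact ⟨_, (Sig.andor _ (h.mono (le_max_left k k')) (h'.mono (le_max_right k k'))).1⟩

theorem Arith.imp (h : Arith A) (h' : Arith B) : Arith (fun x a => A x a → B x a) :=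
  (h.and h'.not).not.of_eq fun x a => by tauto

theorem Arith.iff (h : Arith A) (h' : Arith B) : Arith (fun x a => A x a ↔ B x a) :=
  ((h.imp h').and (h'.imp h)).of_eq fun x a => by tauto

theorem Arith.exN {A : (ℕ → Bool) → α → ℕ → Prop}
    (h : Arith (fun x (p : α × ℕ) => A x p.1 p.2)) : Arith (fun x a => ∃ b, A x a b) := by
  obtain ⟨k, h⟩ := h.not
  exact ⟨k+1, _, h, fun x a => by simp⟩

theorem Arith.ex [Inhabited β] {A : (ℕ → Bool) → α → β → Prop}
    (h : Arith (fun x (p : α × β) => A x p.1 p.2)) : Arith (fun x a => ∃ b, A x a b) := by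
  have h1 : Primrec (fun p : α × ℕ => (p.1, ((Encodable.decode p.2 : Option β)).getD default)) :=
    Primrec.fst.pair (Primrec.option_getD.comp (Primrec.decode.comp Primrec.snd)
      (Primrec.const default))
  refine (Arith.exN (A := fun x a n => A x a ((Encodable.decode n : Option β).getD default))
    (h.comp h1)).of_eq fun x a => ?_
  constructor
  · rintro ⟨n, h⟩; exact ⟨_, h⟩
  · rintro ⟨b, h⟩; exact ⟨Encodable.encode b, by simpa using h⟩

theorem Arith.all [Inhabited β] {A : (ℕ → Bool) → α → β → Prop}
    (h : Arith (fun x (p : α × β) => A x p.1 p.2)) : Arith (fun x a => ∀ b, A x a b) :=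
  (Arith.ex (A := fun x a b => ¬ A x a b) h.not).not.of_eq fun x a => by simp

theorem Arith.pred {A : α → Prop} (h : PrimrecPred A) : Arith (fun _ a => A a) :=
  ⟨0, Sig.pref (R := fun _ a => A a) (h.comp Primrec.snd) (Primrec.const 0)⟩

theorem Arith.real {f : α → ℕ} (hf : Primrec f) : Arith (fun x a => x (f a) = true) := by
  refine Arith.of_eq ⟨0, Sig.pref (R := fun s a => s.getD (f a) false = true)
    (Primrec.eq.comp ((Primrec.list_getD false).comp Primrec.fst (hf.comp Primrec.snd))
      (Primrec.const true)) (Primrec.succ.comp hf)⟩ ?_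
  intro x a
  simp [List.getD_eq_getElem?_getD, pref_getElem]

theorem evalDom {e n : ℕ} : (Code.eval (Denumerable.ofNat Code e) n).Dom ↔
    ∃ k, (Code.evaln k (Denumerable.ofNat Code e) n).isSome = true := by
  simp only [Part.dom_iff_mem, Code.evaln_complete, Option.isSome_iff_exists]
  exact exists_comm

theorem primrec_kernel {f g h : α → ℕ} (hf : Primrec f) (hg : Primrec g) (hh : Primrec h) :
    PrimrecPred (fun a => (Code.evaln (f a) (Denumerable.ofNat Code (g a)) (h a)).isSome = true) :=
  Primrec.eq.comp (Primrec.option_isSome.comp (Code.primrec_evaln.comp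
    ((hf.pair ((Primrec.ofNat Code).comp hg)).pair hh))) (Primrec.const true)

theorem Arith.U0 {f g : α → ℕ} (hf : Primrec f) (hg : Primrec g) :
    Arith (fun x a => U 0 x (f a) (g a)) := by
  simp only [U, evalDom]
  refine Arith.exN (Arith.exN ?_)
  refine ⟨0, Sig.pref (R := fun s (p : (α × ℕ) × ℕ) => (Code.evaln p.2 (Denumerable.ofNat Code
    (f p.1.1)) (Nat.pair (Encodable.encode s) (g p.1.1))).isSome = true) (f := fun p => p.1.2)
    ?_ (Primrec.snd.comp Primrec.fst)⟩
  have e : Primrec (fun q : List Bool × ((α × ℕ) × ℕ) => q.2.1.1) :=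
    Primrec.fst.comp (Primrec.fst.comp Primrec.snd)
  exact primrec_kernel (Primrec.snd.comp Primrec.snd) (hf.comp e)
    (Primrec₂.natPair.comp (Primrec.encode.comp Primrec.fst) (hg.comp e))

open Classical in
/-- The `a`-th r.e. set in `x`, as a real. -/
noncomputable def Sec (x : ℕ → Bool) (a : ℕ) : ℕ → Bool := fun v => decide (U 0 x a v)

theorem Sec_iff {x : ℕ → Bool} {a v : ℕ} : Sec x a v = true ↔ U 0 x a v := by simp [Sec]

theorem exists_pref {y : ℕ → Bool} {Q : List Bool → Prop} :
    (∃ s, Q (pref y s)) ↔ ∃ σ : List Bool, (∀ i, i < σ.length →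
      (σ.getD i false = true ↔ y i = true)) ∧ Q σ := by
  constructor
  · rintro ⟨s, h⟩
    refine ⟨_, ?_, h⟩
    intro i hi
    rw [pref_length] at hi
    simp [List.getD_eq_getElem?_getD, pref_getElem, hi]
  · rintro ⟨σ, h1, h2⟩
    have : pref y σ.length = σ := by
      apply List.ext_getElem?
      intro i
      rw [pref_getElem]
      split_ifs with hi
      · have := h1 i hi
        rw [List.getD_eq_getElem _ _ hi, ← Bool.eq_iff_iff] at this
        rw [List.getElem?_eq_getElem hi, this]
      · simp; omega
    exact ⟨_, by rwa [this]⟩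

theorem Arith.USec {f g h : α → ℕ} (hf : Primrec f) (hg : Primrec g) (hh : Primrec h) :
    Arith (fun x a => U 0 (Sec x (f a)) (g a) (h a)) := by
  have : ∀ x a, (∃ σ : List Bool, (∀ i, i < σ.length → (σ.getD i false = true ↔ U 0 x (f a) i)) ∧
      ∃ k, (Code.evaln k (Denumerable.ofNat Code (g a))
        (Nat.pair (Encodable.encode σ) (h a))).isSome = true) ↔ U 0 (Sec x (f a)) (g a) (h a) := by
    intro x a
    rw [U, exists_pref (Q := fun σ => (Code.eval (Denumerable.ofNat Code (g a))
      (Nat.pair (Encodable.encode σ) (h a))).Dom)]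
    simp only [evalDom, Sec_iff]
  refine Arith.of_eq ?_ this
  refine Arith.ex (Arith.and (Arith.all (Arith.imp (Arith.pred ?_) (Arith.iff (Arith.pred ?_)
    (Arith.U0 ?_ ?_)))) (Arith.ex (Arith.pred (primrec_kernel ?_ ?_ ?_))))
  · exact Primrec.nat_lt.comp Primrec.snd
      (Primrec.list_length.comp (Primrec.snd.comp Primrec.fst))
  · exact Primrec.eq.comp ((Primrec.list_getD false).comp (Primrec.snd.comp Primrec.fst)
      Primrec.snd) (Primrec.const true)
  · exact hf.comp (Primrec.fst.comp Primrec.fst)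
  · exact Primrec.snd
  · exact Primrec.snd
  · exact hg.comp (Primrec.fst.comp Primrec.fst)
  · exact Primrec₂.natPair.comp (Primrec.encode.comp (Primrec.snd.comp Primrec.fst))
      (hh.comp (Primrec.fst.comp Primrec.fst))

theorem term_primrec {n : ℕ} (xs : Fin n → α → ℕ) (hxs : ∀ i, Primrec (xs i))
    (t : L.Term (Empty ⊕ Fin n)) : ∃ h : α → ℕ, Primrec h ∧ ∀ (x y : ℕ → Bool) (p : α),
      @Term.realize L ℕ (str x y) _ (Sum.elim default (fun i => xs i p)) t = h p := by
  induction t with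
  | var i =>
    rcases i with i | i
    · exact i.elim
    · exact ⟨xs i, hxs i, fun x y p => rfl⟩
  | func F ts ih =>
    choose h h1 h2 using ih
    cases F with
    | zero => exact ⟨fun _ => 0, Primrec.const 0, fun x y p => rfl⟩
    | succ =>
      exact ⟨fun p => h 0 p + 1, Primrec.succ.comp (h1 0), fun x y p =>
        congrArg (· + 1) (h2 0 x y p)⟩
    | add =>
      exact ⟨fun p => h 0 p + h 1 p, Primrec.nat_add.comp (h1 0) (h1 1), fun x y p =>
        congrArg₂ (· + ·) (h2 0 x y p) (h2 1 x y p)⟩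
    | mul =>
      exact ⟨fun p => h 0 p * h 1 p, Primrec.nat_mul.comp (h1 0) (h1 1), fun x y p =>
        congrArg₂ (· * ·) (h2 0 x y p) (h2 1 x y p)⟩

end

theorem Arith.formula {n : ℕ} (fm : L.BoundedFormula Empty n) :
    ∀ {α : Type} [Primcodable α] {f g : α → ℕ} (_ : Primrec f) (_ : Primrec g)
    (xs : Fin n → α → ℕ) (_ : ∀ i, Primrec (xs i)),
    Arith (fun x p => @BoundedFormula.Realize L ℕ (str (Sec x (f p)) (Sec x (g p))) Empty n fm
      default (fun i => xs i p)) := by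
  induction fm with
  | falsum =>
    intro α _ f g hf hg xs hxs
    exact Arith.pred (A := fun _ => False) (PrimrecPred.of_eq (Primrec.eq.comp (Primrec.const 0)
      (Primrec.const 1) : PrimrecPred fun _ : α => 0 = 1) (by simp))
  | equal t₁ t₂ =>
    intro α _ f g hf hg xs hxs
    obtain ⟨h, h1, h2⟩ := term_primrec xs hxs t₁
    obtain ⟨h', h1', h2'⟩ := term_primrec xs hxs t₂
    refine (Arith.pred (Primrec.eq.comp h1 h1')).of_eq fun x p => ?_
    exact iff_of_eq (congrArg₂ (· = ·) (h2 (Sec x (f p)) (Sec x (g p)) p).symm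
      (h2' (Sec x (f p)) (Sec x (g p)) p).symm)
  | rel R ts =>
    intro α _ f g hf hg xs hxs
    have := fun i => term_primrec xs hxs (ts i)
    choose h h1 h2 using this
    cases R with
    | fst =>
      refine (Arith.U0 hf (h1 0)).of_eq fun x p => ?_
      exact Sec_iff.symm.trans (iff_of_eq (congrArg (fun v => Sec x (f p) v = true)
        (h2 0 (Sec x (f p)) (Sec x (g p)) p).symm))
    | snd =>
      refine (Arith.U0 hg (h1 0)).of_eq fun x p => ?_
      exact Sec_iff.symm.trans (iff_of_eq (congrArg (fun v => Sec x (g p) v = true)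
        (h2 0 (Sec x (f p)) (Sec x (g p)) p).symm))
    | le =>
      refine (Arith.pred (Primrec.nat_le.comp (h1 0) (h1 1))).of_eq fun x p => ?_
      exact iff_of_eq (congrArg₂ (· ≤ ·) (h2 0 (Sec x (f p)) (Sec x (g p)) p).symm
        (h2 1 (Sec x (f p)) (Sec x (g p)) p).symm)
  | imp _ _ ih1 ih2 =>
    intro α _ f g hf hg xs hxs
    exact (ih1 hf hg xs hxs).imp (ih2 hf hg xs hxs)
  | @all n fm ih =>
    intro α _ f g hf hg xs hxs
    have := ih (α := α × ℕ) (hf.comp Primrec.fst) (hg.comp Primrec.fst)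
      (Fin.snoc (α := fun _ => α × ℕ → ℕ) (fun i p => xs i p.1) (fun p => p.2)) (by
        intro i
        refine Fin.lastCases ?_ (fun i => ?_) i
        · simp only [Fin.snoc_last]; exact Primrec.snd
        · simp only [Fin.snoc_castSucc]; exact (hxs i).comp Primrec.fst)
    refine (Arith.all (β := ℕ) (A := fun x a b => @BoundedFormula.Realize L ℕ
      (str (Sec x (f a)) (Sec x (g a))) Empty _ fm default
      (Fin.snoc (α := fun _ => ℕ) (fun i => xs i a) b)) (this.of_eq fun x p => ?_)).of_eq
      fun x p => Iff.rfl
    have e : (fun i => (Fin.snoc (α := fun _ => α × ℕ → ℕ) (fun i p => xs i p.1) (fun p => p.2) :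
        Fin (n+1) → α × ℕ → ℕ) i p) = Fin.snoc (α := fun _ => ℕ) (fun i => xs i p.1) p.2 := by
      funext i
      refine Fin.lastCases ?_ (fun i => ?_) i
      · simp only [Fin.snoc_last]
      · simp only [Fin.snoc_castSucc]
    rw [e]

theorem Arith.P {P : (ℕ → Bool) → (ℕ → Bool) → Prop} (hP : IsArithmetic P) {α : Type}
    [Primcodable α] {f g : α → ℕ} (hf : Primrec f) (hg : Primrec g) :
    Arith (fun x p => P (Sec x (f p)) (Sec x (g p))) := by
  obtain ⟨ψ, hψ⟩ := hP
  refine (Arith.formula ψ hf hg (fun i => i.elim0) (fun i => i.elim0)).of_eq fun x p => ?_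
  rw [hψ]
  unfold Sentence.Realize Formula.Realize
  have : (fun i : Fin 0 => (i.elim0 : α → ℕ) p) = default := Subsingleton.elim _ _
  rw [this]
  congr!

section
variable {O : ℕ → ℕ}

theorem RecursiveIn.ofPartrec {f : ℕ →. ℕ} (h : Nat.Partrec f) : RecursiveIn O f := by
  induction h with
  | zero => exact .zero
  | succ => exact .succ
  | left => exact .left
  | right => exact .right
  | pair _ _ h1 h2 => exact .pair h1 h2
  | comp _ _ h1 h2 => exact .comp h1 h2
  | prec _ _ h1 h2 => exact .prec h1 h2
  | rfind _ h1 => exact .rfind h1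

theorem RecursiveIn.trans {O' : ℕ → ℕ} (hO : RecursiveIn O' (O : ℕ →. ℕ)) {f : ℕ →. ℕ}
    (h : RecursiveIn O f) : RecursiveIn O' f := by
  induction h with
  | zero => exact .zero
  | succ => exact .succ
  | left => exact .left
  | right => exact .right
  | oracle => exact hO
  | pair _ _ h1 h2 => exact .pair h1 h2
  | comp _ _ h1 h2 => exact .comp h1 h2
  | prec _ _ h1 h2 => exact .prec h1 h2
  | rfind _ h1 => exact .rfind h1

/-- total functions recursive in `O` -/
def TR (O : ℕ → ℕ) (f : ℕ → ℕ) : Prop := RecursiveIn O (f : ℕ →. ℕ)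

theorem RecursiveIn.of_eq {f g : ℕ →. ℕ} (h : RecursiveIn O f) (e : ∀ n, f n = g n) :
    RecursiveIn O g := by
  have : f = g := funext e
  exact this ▸ h

theorem TR.of_comp {f : ℕ → ℕ} (h : Computable f) : TR O f :=
  RecursiveIn.ofPartrec (Partrec.nat_iff.1 h)

theorem TR.of_prim {f : ℕ → ℕ} (h : Primrec f) : TR O f := TR.of_comp h.to_comp

theorem TR.comp {f g : ℕ → ℕ} (hf : TR O f) (hg : TR O g) : TR O (fun n => f (g n)) :=
  RecursiveIn.of_eq (RecursiveIn.comp hf hg) fun n => Part.bind_some _ _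

theorem TR.pair {f g : ℕ → ℕ} (hf : TR O f) (hg : TR O g) :
    TR O (fun n => Nat.pair (f n) (g n)) :=
  RecursiveIn.of_eq (RecursiveIn.pair hf hg) fun n => by simp [Seq.seq]

theorem TR.rec {h : ℕ → ℕ} {g : ℕ → ℕ} (hg : TR O g)
    (hs : ∀ n, h (n+1) = g (Nat.pair n (h n))) : TR O h := by
  have h1 : TR O (fun p => g p.unpair.2) := hg.comp .right
  have h0 : TR O (fun _ => h 0) := TR.of_prim (Primrec.const _)
  have := RecursiveIn.prec h0 h1
  have h2 : TR O (fun p => h p.unpair.2) := by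
    refine RecursiveIn.of_eq this fun p => ?_
    show (Nat.rec _ _ p.unpair.2 : Part ℕ) = Part.some (h p.unpair.2)
    induction p.unpair.2 with
    | zero => rfl
    | succ n ih =>
      simp only [ih]
      simp [hs]
  have h3 := h2.comp (TR.pair (TR.of_prim (Primrec.const 0)) (TR.of_prim Primrec.id))
  simpa using h3

theorem TR.pref {x : ℕ → Bool} (h : TR O (fun n => (x n).toNat)) :
    TR O (fun n => Encodable.encode (pref x n)) := by
  have hG : Primrec (fun p : ℕ => Encodable.encode ((Encodable.decode (α := List Bool)
      p.unpair.1).getD [] ++ [decide (p.unpair.2 = 1)])) := by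
    refine Primrec.encode.comp (Primrec.list_concat.comp (Primrec.option_getD.comp
      (Primrec.decode.comp (Primrec.fst.comp Primrec.unpair)) (Primrec.const [])) ?_)
    exact (Primrec.eq.comp (Primrec.snd.comp Primrec.unpair) (Primrec.const 1)).decide
  refine TR.rec (g := fun p => Encodable.encode ((Encodable.decode (α := List Bool)
      p.unpair.2).getD [] ++ [decide ((x p.unpair.1).toNat = 1)])) ?_ ?_
  · have := (TR.of_prim hG).comp (TR.pair (O := O) (RecursiveIn.right) (h.comp RecursiveIn.left))
    simpa using this
  · intro n
    simp [pref_succ]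

theorem sigma_of {x : ℕ → Bool} {A : Set ℕ} {b : ℕ → ℕ} (h : TR (fun n => (x n).toNat) b)
    (hA : ∀ n, n ∈ A ↔ ∃ s, b (Nat.pair n s) = 0) : Sigma01In x A := by
  refine ⟨_, RecursiveIn.rfind h, ?_⟩
  ext n
  rw [hA]
  simp only [Set.mem_ofPred_eq]
  refine Iff.trans ?_ Nat.rfind_dom.symm
  simp

end

/-- characteristic real of a set -/
noncomputable def chi (S : Set ℕ) : ℕ → Bool := by
  classical exact fun n => decide (n ∈ S)

theorem chi_iff {S : Set ℕ} {n : ℕ} : chi S n = true ↔ n ∈ S := by simp [chi]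

def JumpLE (y x : ℕ → Bool) : Prop := ∃ j : ℕ → Bool, IsJump y j ∧ TuringLE j x

theorem TuringLE.trans {x y z : ℕ → Bool} (h : TuringLE x y) (h' : TuringLE y z) : TuringLE x z :=
  RecursiveIn.trans h' h

theorem JumpLE.chi {x y : ℕ → Bool} (h : JumpLE y x) {S : Set ℕ} (hS : Sigma01In y S) :
    TuringLE (chi S) x := by
  obtain ⟨j, ⟨-, hj⟩, hjx⟩ := h
  obtain ⟨f, hf, hf'⟩ := hj S hS
  have h1 : TR (fun n => (x n).toNat) (fun n => (j (f n)).toNat) := TR.comp hjx (TR.of_comp hf)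
  have : (fun n => (j (f n)).toNat) = fun n => (SteelFormalization.chi S n).toNat := by
    funext n
    congr 1
    rw [Bool.eq_iff_iff, chi_iff]
    exact (hf' n).symm
  rw [this] at h1
  exact h1

theorem JumpLE.le {x y : ℕ → Bool} (h : JumpLE y x) : TuringLE y x := by
  have h1 : TR (fun n => (y n).toNat) (fun p => 1 - (y p.unpair.1).toNat) :=
    TR.comp (f := fun v => 1 - v) (TR.of_prim (Primrec.nat_sub.comp (Primrec.const 1) Primrec.id))
      (TR.comp (f := fun n => (y n).toNat) RecursiveIn.oracle RecursiveIn.left)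
  have h2 : Sigma01In y {n | y n = true} := sigma_of h1 (fun n => by
    cases h : y n <;> simp [h])
  have h3 := h.chi h2
  have : SteelFormalization.chi {n | y n = true} = y := by
    funext n
    rw [Bool.eq_iff_iff, chi_iff]
    rfl
  rwa [this] at h3

/-- truth sets -/
def TS (k : ℕ) (x : ℕ → Bool) : Set ℕ := {p | U k x p.unpair.1 p.unpair.2}

theorem sigma_TS0 (x : ℕ → Bool) : Sigma01In x (TS 0 x) := by
  have hk : Primrec (fun q : ℕ => 1 - (Code.evaln q.unpair.1.unpair.2.unpair.1
      (Denumerable.ofNat Code q.unpair.1.unpair.1.unpair.1)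
      (Nat.pair q.unpair.2 q.unpair.1.unpair.1.unpair.2)).isSome.toNat) := by
    have u1 : Primrec (fun n : ℕ => n.unpair.1) := Primrec.fst.comp Primrec.unpair
    have u2 : Primrec (fun n : ℕ => n.unpair.2) := Primrec.snd.comp Primrec.unpair
    refine Primrec.nat_sub.comp (Primrec.const 1) ((Primrec.dom_finite Bool.toNat).comp
      (Primrec.option_isSome.comp (Code.primrec_evaln.comp
      (((u1.comp (u2.comp u1)).pair ((Primrec.ofNat Code).comp (u1.comp (u1.comp u1)))).pair
      (Primrec₂.natPair.comp u2 (u2.comp (u1.comp u1)))))))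
  have h1 := (TR.of_prim (O := fun n => (x n).toNat) hk).comp (TR.pair (TR.of_prim Primrec.id)
    ((TR.pref (x := x) RecursiveIn.oracle).comp (RecursiveIn.right.comp RecursiveIn.right |>.of_eq
      (g := ((fun n : ℕ => n.unpair.2.unpair.2 : ℕ → ℕ) : ℕ →. ℕ)) (fun n => Part.bind_some _ _))))
  refine sigma_of h1 fun n => ?_
  simp only [TS, Set.mem_ofPred_eq, U, evalDom, Nat.unpair_pair, id]
  constructor
  · rintro ⟨s, k, h⟩
    refine ⟨Nat.pair k s, ?_⟩
    simp [h]
  · rintro ⟨p, h⟩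
    refine ⟨p.unpair.2, p.unpair.1, ?_⟩
    by_contra h'
    simp only [Bool.not_eq_true] at h'
    rw [h'] at h
    simp at h

theorem sigma_TS_succ {k : ℕ} {x z : ℕ → Bool} (h : TuringLE (chi (TS k x)) z) :
    Sigma01In z (TS (k+1) x) := by
  have u1 : Primrec (fun n : ℕ => n.unpair.1) := Primrec.fst.comp Primrec.unpair
  have u2 : Primrec (fun n : ℕ => n.unpair.2) := Primrec.snd.comp Primrec.unpair
  have h1 := TR.comp (O := fun n => (z n).toNat) h (g := fun q : ℕ => Nat.pair q.unpair.1.unpair.1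
    (Nat.pair q.unpair.1.unpair.2 q.unpair.2)) (TR.of_prim (Primrec₂.natPair.comp (u1.comp u1)
      (Primrec₂.natPair.comp (u2.comp u1) u2)))
  refine sigma_of h1 fun n => ?_
  simp only [TS, Set.mem_ofPred_eq, U, Nat.unpair_pair]
  refine exists_congr fun s => ?_
  have := chi_iff (S := TS k x) (n := Nat.pair n.unpair.1 (Nat.pair n.unpair.2 s))
  simp only [TS, Set.mem_ofPred_eq, Nat.unpair_pair] at this
  rw [← this]
  simp

theorem TuringLE.index {x y : ℕ → Bool} (h : TuringLE y x) : ∃ a, ∀ v, U 0 x a v ↔ y v = true := by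
  obtain ⟨a, ha⟩ := ((SW.graph h).comp (f := fun v : ℕ => (v, 1))
    (Primrec.id.pair (Primrec.const 1))).index
  refine ⟨a, fun v => (ha v).symm.trans ?_⟩
  cases h : y v <;> simp [h]

def D (P : (ℕ → Bool) → (ℕ → Bool) → Prop) (x : ℕ → Bool) (q : ℕ × ℕ) : Prop :=
  ∀ (l t : List ℕ) (m : ℕ), 1 ≤ m →
    (∀ v, U 0 x (l.getD 0 0) v ↔ x v = true) →
    (∀ i, i < m → P (Sec x (l.getD i 0)) (Sec x (l.getD (i+1) 0))) →
    (∀ e v, U 0 x (t.getD 0 0) (Nat.pair e v) ↔ U 0 (Sec x (l.getD m 0)) e v) →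
    (∀ k, k < q.1 → ∀ e v, U 0 x (t.getD (k+1) 0) (Nat.pair e v) ↔
      ∃ s, ¬ U 0 x (t.getD k 0) (Nat.pair e (Nat.pair v s))) →
    ¬ U 0 x (t.getD q.1 0) (Nat.pair q.2 (Nat.pair q.1 q.2))

theorem Arith.D {P : (ℕ → Bool) → (ℕ → Bool) → Prop} (hP : IsArithmetic P) :
    Arith (D P) := by
  have gd : Primrec₂ (fun (l : List ℕ) n => l.getD n 0) := Primrec.list_getD 0
  have pr : Primrec₂ Nat.pair := Primrec₂.natPair
  let Γ := (((ℕ × ℕ) × List ℕ) × List ℕ) × ℕ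
  have c1 : Primrec (fun p : Γ => p.1.1.1.1) :=
    Primrec.fst.comp (Primrec.fst.comp (Primrec.fst.comp Primrec.fst))
  have c2 : Primrec (fun p : Γ => p.1.1.1.2) :=
    Primrec.snd.comp (Primrec.fst.comp (Primrec.fst.comp Primrec.fst))
  have cl : Primrec (fun p : Γ => p.1.1.2) := Primrec.snd.comp (Primrec.fst.comp Primrec.fst)
  have ct : Primrec (fun p : Γ => p.1.2) := Primrec.snd.comp Primrec.fst
  have cm : Primrec (fun p : Γ => p.2) := Primrec.snd
  unfold SteelFormalization.D
  refine Arith.all (Arith.all (Arith.all (Arith.imp (Arith.pred ?_) (Arith.imp (Arith.all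
    (Arith.iff (Arith.U0 ?_ ?_) (Arith.real ?_))) (Arith.imp (Arith.all (Arith.imp (Arith.pred ?_)
    (Arith.P hP ?_ ?_))) (Arith.imp (Arith.all (Arith.all (Arith.iff (Arith.U0 ?_ ?_)
    (Arith.USec ?_ ?_ ?_)))) (Arith.imp (Arith.all (Arith.imp (Arith.pred ?_) (Arith.all (Arith.all
    (Arith.iff (Arith.U0 ?_ ?_) (Arith.ex (Arith.not (Arith.U0 ?_ ?_)))))))) (Arith.not
    (Arith.U0 ?_ ?_)))))))))
  · exact Primrec.nat_le.comp (Primrec.const 1) cm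
  · exact gd.comp (cl.comp Primrec.fst) (Primrec.const 0)
  · exact Primrec.snd
  · exact Primrec.snd
  · exact Primrec.nat_lt.comp Primrec.snd (cm.comp Primrec.fst)
  · exact gd.comp (cl.comp Primrec.fst) Primrec.snd
  · exact gd.comp (cl.comp Primrec.fst) (Primrec.succ.comp Primrec.snd)
  · exact gd.comp (ct.comp (Primrec.fst.comp Primrec.fst)) (Primrec.const 0)
  · exact pr.comp (Primrec.snd.comp Primrec.fst) Primrec.snd
  · exact gd.comp (cl.comp (Primrec.fst.comp Primrec.fst)) (cm.comp (Primrec.fst.comp Primrec.fst))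
  · exact Primrec.snd.comp Primrec.fst
  · exact Primrec.snd
  · exact Primrec.nat_lt.comp Primrec.snd (c1.comp Primrec.fst)
  · exact gd.comp (ct.comp (Primrec.fst.comp (Primrec.fst.comp Primrec.fst)))
      (Primrec.succ.comp (Primrec.snd.comp (Primrec.fst.comp Primrec.fst)))
  · exact pr.comp (Primrec.snd.comp Primrec.fst) Primrec.snd
  · exact gd.comp (ct.comp (Primrec.fst.comp (Primrec.fst.comp (Primrec.fst.comp Primrec.fst))))
      (Primrec.snd.comp (Primrec.fst.comp (Primrec.fst.comp Primrec.fst)))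
  · exact pr.comp (Primrec.snd.comp (Primrec.fst.comp Primrec.fst))
      (pr.comp (Primrec.snd.comp Primrec.fst) Primrec.snd)
  · exact gd.comp ct c1
  · exact pr.comp c2 (pr.comp c1 c2)

theorem getD_ofFn (f : ℕ → ℕ) (n i : ℕ) (h : i < n) :
    ((List.range n).map f).getD i 0 = f i := by
  simp [List.getD_eq_getElem?_getD, h]

theorem chain {P : (ℕ → Bool) → (ℕ → Bool) → Prop} {x : ℕ → (ℕ → Bool)}
    (hu : ∀ n y, P (x n) y → y = x (n+1)) {n m : ℕ} {l : List ℕ}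
    (h0 : ∀ v, U 0 (x n) (l.getD 0 0) v ↔ x n v = true)
    (h : ∀ i, i < m → P (Sec (x n) (l.getD i 0)) (Sec (x n) (l.getD (i+1) 0))) :
    ∀ i ≤ m, Sec (x n) (l.getD i 0) = x (n + i) := by
  intro i
  induction i with
  | zero =>
    intro _
    funext v
    rw [Bool.eq_iff_iff, Sec_iff]
    exact h0 v
  | succ i ih =>
    intro hi
    have := h i (by omega)
    rw [ih (by omega)] at this
    exact hu _ _ this

theorem truth {x y : ℕ → Bool} {t : List ℕ} {c : ℕ}
    (h0 : ∀ e v, U 0 x (t.getD 0 0) (Nat.pair e v) ↔ U 0 y e v)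
    (h : ∀ k, k < c → ∀ e v, U 0 x (t.getD (k+1) 0) (Nat.pair e v) ↔
      ∃ s, ¬ U 0 x (t.getD k 0) (Nat.pair e (Nat.pair v s))) :
    ∀ k ≤ c, ∀ e v, U 0 x (t.getD k 0) (Nat.pair e v) ↔ U k y e v := by
  intro k
  induction k with
  | zero => intro _; exact h0
  | succ k ih =>
    intro hk e v
    rw [h k (by omega), U]
    simp only [ih (by omega)]

theorem main {P : (ℕ → Bool) → (ℕ → Bool) → Prop} (hP : IsArithmetic P) (x : ℕ → (ℕ → Bool))
    (hj : ∀ n, JumpLE (x (n+1)) (x n)) (hp : ∀ n, P (x n) (x (n+1)))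
    (hu : ∀ n y, P (x n) y → y = x (n+1)) : False := by
  obtain ⟨c, hc⟩ := Arith.D hP
  obtain ⟨e, he⟩ := hc.univ
  have hle : ∀ n m, TuringLE (x (n+m)) (x n) := by
    intro n m
    induction m with
    | zero => exact RecursiveIn.oracle
    | succ m ih => exact (hj (n+m)).le.trans ih
  have hT : ∀ k n, TuringLE (chi (TS k (x (n+k+1)))) (x n) := by
    intro k
    induction k with
    | zero => intro n; exact (hj n).chi (sigma_TS0 _)
    | succ k ih =>
      intro n
      refine (hj n).chi (sigma_TS_succ ?_)
      have := ih (n+1)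
      rwa [show n + 1 + k + 1 = n + (k+1) + 1 by omega] at this
  let θ : ℕ → Prop := fun n => D P (x n) (c, e)
  have hθ : ∀ n, θ n ↔ U c (x n) e (Nat.pair c e) := fun n => he (x n) (c, e)
  have A1 : ∀ n m, c + 1 ≤ m → θ n → ¬ θ (n + m) := by
    intro n m hm hn hnm
    rw [hθ] at hnm
    have ha : ∀ i, ∃ a, ∀ v, U 0 (x n) a v ↔ x (n+i) v = true := fun i => (hle n i).index
    choose a ha using ha
    have hb : ∀ k, ∃ b, k ≤ c → ∀ v, U 0 (x n) b v ↔ v ∈ TS k (x (n+m)) := by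
      intro k
      by_cases hk : k ≤ c
      · have h1 := hT k (n + m - k - 1)
        rw [show n + m - k - 1 + k + 1 = n + m by omega] at h1
        have h2 := hle n (m - k - 1)
        rw [show n + (m - k - 1) = n + m - k - 1 by omega] at h2
        obtain ⟨b, hb⟩ := (h1.trans h2).index
        exact ⟨b, fun _ v => (hb v).trans chi_iff⟩
      · exact ⟨0, fun h => absurd h hk⟩
    choose b hb using hb
    have hS : ∀ i, Sec (x n) (a i) = x (n+i) := by
      intro i
      funext v
      rw [Bool.eq_iff_iff, Sec_iff]
      exact ha i v
    refine hn ((List.range (m+1)).map a) ((List.range (c+1)).map b) m (by omega) ?_ ?_ ?_ ?_ ?_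
    · intro v
      rw [getD_ofFn _ _ _ (by omega)]
      exact ha 0 v
    · intro i hi
      rw [getD_ofFn _ _ _ (by omega), getD_ofFn _ _ _ (by omega), hS, hS]
      exact hp (n+i)
    · intro e v
      rw [getD_ofFn _ _ _ (by omega), getD_ofFn _ _ _ (by omega), hS, hb 0 (by omega)]
      simp [TS]
    · intro k hk e v
      simp only at hk
      rw [getD_ofFn _ _ _ (by omega), getD_ofFn _ _ _ (by omega), hb (k+1) (by omega)]
      simp only [hb k (by omega)]
      simp only [TS, Set.mem_ofPred_eq, Nat.unpair_pair, U]
    · simp only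
      rw [getD_ofFn _ _ _ (by omega), hb c le_rfl]
      simpa [TS] using hnm
  have A2 : ∀ n, ¬ θ n → ∃ m, 1 ≤ m ∧ θ (n + m) := by
    intro n hn
    by_contra hcon
    push Not at hcon
    apply hn
    intro l t m hm h0 h1 h2 h3 h4
    have e1 := chain hu h0 h1 m le_rfl
    rw [e1] at h2
    have := truth h2 h3 c le_rfl e (Nat.pair c e)
    exact hcon m hm ((hθ _).2 (this.1 h4))
  have A3 : ∀ n, ¬ θ n := by
    intro n hn
    obtain ⟨m, hm, h⟩ := A2 (n + (c+1)) (A1 n (c+1) le_rfl hn)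
    rw [add_assoc] at h
    exact A1 n (c + 1 + m) (by omega) hn h
  obtain ⟨m, -, h⟩ := A2 0 (A3 0)
  exact A3 _ h

/-- Steel.  Let `P ⊆ ℝ²` be arithmetic.  Then there is no sequence
of reals `(x_n)` such that for every `n`: (i) `x'_(n+1) ≤_T x_n`, and (ii) `x_(n+1)`
is the unique `y` such that `P (x_n) y`. -/
theorem statement_18 (P : (ℕ → Bool) → (ℕ → Bool) → Prop) (hP : IsArithmetic P) :
    ¬ ∃ x : ℕ → (ℕ → Bool), ∀ n : ℕ,
      (∃ j : ℕ → Bool, IsJump (x (n + 1)) j ∧ TuringLE j (x n)) ∧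
      (P (x n) (x (n + 1)) ∧ ∀ y : ℕ → Bool, P (x n) y → y = x (n + 1)) := by
  rintro ⟨x, h⟩
  exact main hP x (fun n => (h n).1) (fun n => (h n).2.1) (fun n => (h n).2.2)

end SteelFormalization
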